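/- arXiv:1603.04166 — 4 statements merged into one kernel-verified Lean document; each statement's English description precedes it below -/
import Mathlib

section
/- For every fixed μ ∈ ℝ^d, the function x ↦ ψ(x;μ) is concave on ℝ^d. -/
open MeasureTheory Real Filter Matrix

/-- Standard normal density on ℝ. -/
noncomputable def stdPdf (t : ℝ) : ℝ := (Real.sqrt (2 * Real.pi))⁻¹ * Real.exp (-t ^ 2 / 2)

/-- Standard normal cumulative distribution function Φ. -/
noncomputable def Phi (t : ℝ) : ℝ := ∫ s in Set.Iic t, stdPdf s

/-- Standard `d`-dimensional normal density φ_d(x) = (2π)^{-d/2} exp(-‖x‖²/2). -/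
noncomputable def phiD {d : ℕ} (x : Fin d → ℝ) : ℝ :=
  ((Real.sqrt (2 * Real.pi)) ^ d)⁻¹ * Real.exp (-(∑ i, x i ^ 2) / 2)

/-- The sequential bound l̃_k(x) = (l_k − Σ_{j<k} L_{kj} x_j)/L_{kk}
    (and likewise ũ_k(x) upon replacing `l` by `u`). -/
noncomputable def lTil {d : ℕ} (L : Matrix (Fin d) (Fin d) ℝ) (l : Fin d → ℝ)
    (x : Fin d → ℝ) (k : Fin d) : ℝ :=
  (l k - ∑ j ∈ Finset.Iio k, L k j * x j) / L k k

/-- The polytope 𝒞 = {x : l ≤ Lx ≤ u}. -/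
def Cset {d : ℕ} (L : Matrix (Fin d) (Fin d) ℝ) (l u : Fin d → ℝ) : Set (Fin d → ℝ) :=
  {x | ∀ i, l i ≤ L.mulVec x i ∧ L.mulVec x i ≤ u i}

/-- ψ(x;μ) = −xᵀμ + ‖μ‖²/2 + Σ_k log(Φ(ũ_k(x) − μ_k) − Φ(l̃_k(x) − μ_k)). -/
noncomputable def psi {d : ℕ} (L : Matrix (Fin d) (Fin d) ℝ) (l u : Fin d → ℝ)
    (x μ : Fin d → ℝ) : ℝ :=
  -(∑ i, x i * μ i) + (∑ i, μ i ^ 2) / 2 +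
    ∑ k, Real.log (Phi (lTil L u x k - μ k) - Phi (lTil L l x k - μ k))

/-- Sequential importance-sampling density g(x;μ). -/
noncomputable def gdens {d : ℕ} (L : Matrix (Fin d) (Fin d) ℝ) (l u : Fin d → ℝ)
    (x μ : Fin d → ℝ) : ℝ :=
  ∏ k, stdPdf (x k - μ k) *
      (if lTil L l x k ≤ x k ∧ x k ≤ lTil L u x k then (1 : ℝ) else 0) /
      (Phi (lTil L u x k - μ k) - Phi (lTil L l x k - μ k))

/-- ℓ = ∫_𝒞 φ_d(x) dx. -/
noncomputable def lval {d : ℕ} (L : Matrix (Fin d) (Fin d) ℝ) (l u : Fin d → ℝ) : ℝ :=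
  ∫ x in Cset L l u, phiD x

theorem stdPdf_pos (t : ℝ) : 0 < stdPdf t := by
  unfold stdPdf
  positivity

theorem hasDerivAt_stdPdf (t : ℝ) : HasDerivAt stdPdf (-t * stdPdf t) t := by
  have h : HasDerivAt (fun s : ℝ => -s ^ 2 / 2) (-t) t := by
    refine ((hasDerivAt_pow 2 t).neg.div_const 2).congr_deriv ?_
    norm_num
    ring
  refine (h.exp.const_mul (Real.sqrt (2 * Real.pi))⁻¹).congr_deriv ?_
  unfold stdPdf
  ring

theorem continuous_stdPdf : Continuous stdPdf :=
  continuous_iff_continuousAt.2 fun t => (hasDerivAt_stdPdf t).continuousAt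

theorem integrable_stdPdf : Integrable stdPdf := by
  refine ((integrable_exp_neg_mul_sq (b := 1 / 2) (by norm_num)).const_mul
    (Real.sqrt (2 * Real.pi))⁻¹).congr (ae_of_all _ fun t => ?_)
  simp only [stdPdf]
  ring_nf

theorem hasDerivAt_Phi (t : ℝ) : HasDerivAt Phi (stdPdf t) t := by
  have h : Phi = fun y => Phi 0 + ∫ s in (0 : ℝ)..y, stdPdf s := by
    funext y
    have := intervalIntegral.integral_Iic_sub_Iic (μ := volume) (a := 0) (b := y)
      integrable_stdPdf.integrableOn integrable_stdPdf.integrableOn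
    rw [← this]
    simp only [Phi]
    ring
  rw [h]
  exact (continuous_stdPdf.integral_hasStrictDerivAt 0 t).hasDerivAt.const_add _

theorem strictMono_Phi : StrictMono Phi :=
  strictMono_of_hasDerivAt_pos hasDerivAt_Phi stdPdf_pos

/-- The standard normal mean over an interval lies in its interior. -/
theorem exists_stdPdf_sub_eq {a b : ℝ} (hab : a < b) :
    ∃ ξ ∈ Set.Ioo a b, stdPdf a - stdPdf b = ξ * (Phi b - Phi a) := by
  obtain ⟨ξ, hξ, h⟩ := exists_ratio_hasDerivAt_eq_ratio_slope Phi stdPdf hab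
    (fun x _ => (hasDerivAt_Phi x).continuousAt.continuousWithinAt)
    (fun x _ => hasDerivAt_Phi x) stdPdf (fun x => -x * stdPdf x)
    continuous_stdPdf.continuousOn (fun x _ => hasDerivAt_stdPdf x)
  refine ⟨ξ, hξ, mul_right_cancel₀ (stdPdf_pos ξ).ne' ?_⟩
  linear_combination -h

/-- The standard normal mass of a translated interval is log-concave in the translation. -/
theorem concaveOn_log_Phi_sub {c : ℝ} (hc : 0 < c) :
    ConcaveOn ℝ Set.univ fun t => Real.log (Phi (t + c) - Phi t) := by
  have hpos (t : ℝ) : 0 < Phi (t + c) - Phi t :=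
    sub_pos.2 (strictMono_Phi (lt_add_of_pos_right t hc))
  have hF (t : ℝ) : HasDerivAt (fun t => Phi (t + c) - Phi t) (stdPdf (t + c) - stdPdf t) t :=
    ((hasDerivAt_Phi (t + c)).comp_add_const t c).sub (hasDerivAt_Phi t)
  have hlog (t : ℝ) := (hF t).log (hpos t).ne'
  have hquot (t : ℝ) :=
    (((hasDerivAt_stdPdf (t + c)).comp_add_const t c).sub (hasDerivAt_stdPdf t)).div
      (hF t) (hpos t).ne'
  refine Antitone.concaveOn_univ_of_deriv (fun t => (hlog t).differentiableAt) ?_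
  rw [show deriv (fun t => Real.log (Phi (t + c) - Phi t)) = _ from
    funext fun t => (hlog t).deriv]
  refine antitone_of_hasDerivAt_nonpos hquot fun t => ?_
  refine div_nonpos_of_nonpos_of_nonneg ?_ (sq_nonneg _)
  obtain ⟨ξ, ⟨h₁, h₂⟩, h⟩ := exists_stdPdf_sub_eq (lt_add_of_pos_right t hc)
  have key : 0 ≤ (stdPdf t * (ξ - t) + stdPdf (t + c) * (t + c - ξ)) * (Phi (t + c) - Phi t) :=
    mul_nonneg (add_nonneg (mul_nonneg (stdPdf_pos _).le (by linarith))
      (mul_nonneg (stdPdf_pos _).le (by linarith))) (hpos t).le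
  simp only [Pi.sub_apply]
  linear_combination key - (stdPdf t - stdPdf (t + c)) * h

theorem lTil_combo {d : ℕ} (L : Matrix (Fin d) (Fin d) ℝ) (l x y : Fin d → ℝ) (k : Fin d)
    {a b : ℝ} (hab : a + b = 1) :
    lTil L l (a • x + b • y) k = a * lTil L l x k + b * lTil L l y k := by
  have hsum : ∑ j ∈ Finset.Iio k, L k j * (a • x + b • y) j =
      a * ∑ j ∈ Finset.Iio k, L k j * x j + b * ∑ j ∈ Finset.Iio k, L k j * y j := by
    rw [Finset.mul_sum, Finset.mul_sum, ← Finset.sum_add_distrib]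
    refine Finset.sum_congr rfl fun j _ => ?_
    simp only [Pi.add_apply, Pi.smul_apply, smul_eq_mul]
    ring
  simp only [lTil, hsum]
  linear_combination (-l k / L k k) * hab

theorem lTil_eq_add {d : ℕ} (L : Matrix (Fin d) (Fin d) ℝ) (l u x : Fin d → ℝ) (k : Fin d) :
    lTil L u x k = lTil L l x k + (u k - l k) / L k k := by
  simp only [lTil]
  ring

/-- for every fixed μ, x ↦ ψ(x;μ) is concave on ℝ^d. -/
theorem psi_concave_in_x {d : ℕ} (hd : 1 ≤ d)
    (L : Matrix (Fin d) (Fin d) ℝ)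
    (hLow : ∀ i j : Fin d, i < j → L i j = 0)
    (hDiag : ∀ i, 0 < L i i)
    (l u : Fin d → ℝ) (hlu : ∀ k, l k < u k)
    (μ : Fin d → ℝ) :
    ConcaveOn ℝ Set.univ (fun x => psi L l u x μ) := by
  refine ⟨convex_univ, fun x _ y _ a b ha hb hab => ?_⟩
  have hlog : a * ∑ k, Real.log (Phi (lTil L u x k - μ k) - Phi (lTil L l x k - μ k)) +
      b * ∑ k, Real.log (Phi (lTil L u y k - μ k) - Phi (lTil L l y k - μ k)) ≤
      ∑ k, Real.log (Phi (lTil L u (a • x + b • y) k - μ k) -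
        Phi (lTil L l (a • x + b • y) k - μ k)) := by
    rw [Finset.mul_sum, Finset.mul_sum, ← Finset.sum_add_distrib]
    refine Finset.sum_le_sum fun k _ => ?_
    have h := (concaveOn_log_Phi_sub (div_pos (sub_pos.2 (hlu k)) (hDiag k))).2
      (Set.mem_univ (lTil L l x k - μ k)) (Set.mem_univ (lTil L l y k - μ k)) ha hb hab
    simp only [smul_eq_mul] at h
    have hcombo : a * (lTil L l x k - μ k) + b * (lTil L l y k - μ k) =
        lTil L l (a • x + b • y) k - μ k := by
      rw [lTil_combo L l x y k hab]
      linear_combination (-μ k) * hab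
    rw [hcombo] at h
    simpa only [lTil_eq_add L l u, add_sub_right_comm] using h
  have hlin : ∑ i, (a • x + b • y) i * μ i = a * ∑ i, x i * μ i + b * ∑ i, y i * μ i := by
    rw [Finset.mul_sum, Finset.mul_sum, ← Finset.sum_add_distrib]
    refine Finset.sum_congr rfl fun j _ => ?_
    simp only [Pi.add_apply, Pi.smul_apply, smul_eq_mul]
    ring
  simp only [psi, smul_eq_mul, hlin]
  linear_combination hlog + ((∑ i, μ i ^ 2) / 2) * hab
end

section
/- Total-variation bound for the tilted proposal: assume ℓ > 0 and let f(x) = φ_d(x)·1{x ∈ 𝒞}/ℓ be the truncated standard normal density on 𝒞. Then for every μ ∈ ℝ^d with S(μ) := sup_{x∈𝒞} ψ(x;μ) < ∞, the Kullback–Leibler divergence satisfies ∫ f(x) log(f(x)/g(x;μ)) dx ≤ S(μ) − log ℓ, and consequently (1/2)∫_{ℝ^d} |f(x) − g(x;μ)| dx ≤ sqrt(1 − ℓ · exp(−S(μ))). -/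
open MeasureTheory Real Filter Matrix

theorem Phi_sub_Phi (a b : ℝ) : Phi b - Phi a = ∫ t in a..b, stdPdf t :=
  intervalIntegral.integral_Iic_sub_Iic integrable_stdPdf.integrableOn
    integrable_stdPdf.integrableOn

theorem lintegral_truncated_stdPdf_le_one {a b : ℝ} (hab : a < b) (m : ℝ) :
    ∫⁻ t, ENNReal.ofReal (stdPdf (t - m) * (if a ≤ t ∧ t ≤ b then (1 : ℝ) else 0) /
      (Phi (b - m) - Phi (a - m))) ≤ 1 := by
  have hD : 0 < Phi (b - m) - Phi (a - m) :=
    sub_pos.2 (strictMono_Phi (sub_lt_sub_right hab m))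
  have hfun : (fun t => stdPdf (t - m) * (if a ≤ t ∧ t ≤ b then (1 : ℝ) else 0) /
      (Phi (b - m) - Phi (a - m))) = (Set.Icc a b).indicator
        (fun t => stdPdf (t - m) / (Phi (b - m) - Phi (a - m))) := by
    ext t
    by_cases h : a ≤ t ∧ t ≤ b <;> simp [Set.indicator, h]
  have hint : Integrable (fun t => stdPdf (t - m) / (Phi (b - m) - Phi (a - m))) :=
    (integrable_stdPdf.comp_sub_right m).div_const _
  rw [← ofReal_integral_eq_lintegral_ofReal]
  · rw [hfun, integral_indicator measurableSet_Icc, integral_Icc_eq_integral_Ioc,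
      ← intervalIntegral.integral_of_le hab.le, intervalIntegral.integral_div,
      intervalIntegral.integral_comp_sub_right, ← Phi_sub_Phi, div_self hD.ne']
    simp
  · rw [hfun]
    exact hint.indicator measurableSet_Icc
  · refine Eventually.of_forall fun t => ?_
    have := stdPdf_pos (t - m)
    dsimp only [Pi.zero_apply]
    split_ifs <;> positivity

/-- A product of sequential conditional sub-densities has total mass at most one. -/
theorem lintegral_prod_sequential_le_one {n : ℕ} (H : Fin n → (Fin n → ℝ) → ENNReal)
    (hmeas : ∀ k, Measurable (H k))
    (hdep : ∀ k x y, (∀ j ≤ k, x j = y j) → H k x = H k y)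
    (hmass : ∀ k x, ∫⁻ t, H k (Function.update x k t) ≤ 1) :
    ∫⁻ x, ∏ k, H k x ≤ 1 := by
  induction n with
  | zero => simp [volume_pi]
  | succ n ih =>
    have hsnoc : Measurable fun p : ℝ × (Fin n → ℝ) => (Fin.snoc p.2 p.1 : Fin (n + 1) → ℝ) := by
      refine measurable_pi_iff.2 fun i => ?_
      refine Fin.lastCases ?_ (fun j => ?_) i
      · simpa using measurable_fst
      · simpa [Function.comp_def] using (measurable_pi_apply j).comp measurable_snd
    have hsnoc0 : Measurable fun y : Fin n → ℝ => (Fin.snoc y (0 : ℝ) : Fin (n + 1) → ℝ) :=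
      hsnoc.comp (measurable_const.prodMk measurable_id)
    have hinit : ∀ (k : Fin n) (y : Fin n → ℝ) (t : ℝ),
        H k.castSucc (Fin.snoc y t) = H k.castSucc (Fin.snoc y 0) := by
      intro k y t
      refine hdep _ _ _ fun j => ?_
      refine Fin.lastCases (fun hj => ?_) (fun j _ => by simp) j
      exact absurd (Fin.castSucc_lt_last k) (not_lt.2 hj)
    have key := ih (fun k y => H k.castSucc (Fin.snoc y 0)) (fun k => (hmeas _).comp hsnoc0)
      (fun k x y hxy => hdep _ _ _ fun j => by
        refine Fin.lastCases (fun _ => by simp) (fun j hj => ?_) j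
        simpa using hxy j (by simpa using hj))
      (fun k x => by
        have := hmass k.castSucc (Fin.snoc x 0)
        simpa only [Fin.snoc_update] using this)
    have hmp := (volume_preserving_piFinSuccAbove (fun _ : Fin (n + 1) => ℝ) (Fin.last n)).symm
    rw [← hmp.lintegral_comp_emb (MeasurableEquiv.measurableEmbedding _)]
    have hcoe : ∀ p : ℝ × (Fin n → ℝ),
        (MeasurableEquiv.piFinSuccAbove (fun _ : Fin (n + 1) => ℝ) (Fin.last n)).symm p
          = Fin.snoc p.2 p.1 := fun p => by
      simp [MeasurableEquiv.piFinSuccAbove, Fin.insertNthEquiv]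
    simp only [hcoe]
    rw [Measure.volume_eq_prod, lintegral_prod_symm]
    · refine le_trans (lintegral_mono fun y => ?_) key
      simp only [Fin.prod_univ_castSucc, hinit]
      rw [lintegral_const_mul]
      · have := hmass (Fin.last n) (Fin.snoc y 0)
        simp only [Fin.update_snoc_last] at this
        exact mul_le_of_le_one_right' this
      · exact (hmeas _).comp (hsnoc.comp (measurable_id.prodMk measurable_const))
    · exact (Finset.measurable_prod _ fun k _ => (hmeas k).comp hsnoc).aemeasurable

section TiltedProposal

variable {d : ℕ} {L : Matrix (Fin d) (Fin d) ℝ} {l u : Fin d → ℝ}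

theorem continuous_lTil (L : Matrix (Fin d) (Fin d) ℝ) (l : Fin d → ℝ) (k : Fin d) :
    Continuous fun x => lTil L l x k := by
  unfold lTil
  fun_prop

theorem lTil_congr (L : Matrix (Fin d) (Fin d) ℝ) (l : Fin d → ℝ) {k : Fin d} {x y : Fin d → ℝ}
    (h : ∀ j < k, x j = y j) : lTil L l x k = lTil L l y k := by
  unfold lTil
  rw [Finset.sum_congr rfl fun j hj => by rw [h j (Finset.mem_Iio.1 hj)]]

theorem lTil_lt_lTil (hDiag : ∀ i, 0 < L i i) (hlu : ∀ k, l k < u k) (x : Fin d → ℝ)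
    (k : Fin d) : lTil L l x k < lTil L u x k :=
  div_lt_div_of_pos_right (sub_lt_sub_right (hlu k) _) (hDiag k)

theorem Phi_lTil_sub_pos (hDiag : ∀ i, 0 < L i i) (hlu : ∀ k, l k < u k) (x μ : Fin d → ℝ)
    (k : Fin d) : 0 < Phi (lTil L u x k - μ k) - Phi (lTil L l x k - μ k) :=
  sub_pos.2 (strictMono_Phi (sub_lt_sub_right (lTil_lt_lTil hDiag hlu x k) _))

theorem mulVec_eq_of_lower (hLow : ∀ i j : Fin d, i < j → L i j = 0) (x : Fin d → ℝ)
    (i : Fin d) : L.mulVec x i = ∑ j ∈ Finset.Iio i, L i j * x j + L i i * x i := by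
  have h : ∑ j ∈ Finset.Iic i, L i j * x j = ∑ j, L i j * x j :=
    Finset.sum_subset (Finset.subset_univ _) fun j _ hj => by
      rw [hLow i j (not_le.1 fun h => hj (Finset.mem_Iic.2 h)), zero_mul]
  rw [Matrix.mulVec, dotProduct, ← h, ← Finset.Iio_insert, Finset.sum_insert (by simp), add_comm]

theorem mem_Cset_iff (hLow : ∀ i j : Fin d, i < j → L i j = 0) (hDiag : ∀ i, 0 < L i i)
    (x : Fin d → ℝ) :
    x ∈ Cset L l u ↔ ∀ k, lTil L l x k ≤ x k ∧ x k ≤ lTil L u x k := by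
  refine forall_congr' fun k => ?_
  rw [mulVec_eq_of_lower hLow, lTil, lTil, div_le_iff₀ (hDiag k), le_div_iff₀ (hDiag k)]
  constructor <;> rintro ⟨h₁, h₂⟩ <;> constructor <;> linarith

theorem measurableSet_Cset (L : Matrix (Fin d) (Fin d) ℝ) (l u : Fin d → ℝ) :
    MeasurableSet (Cset L l u) := by
  have hc : ∀ i, Continuous fun x : Fin d → ℝ => L.mulVec x i := fun i => by
    unfold Matrix.mulVec dotProduct
    fun_prop
  have : Cset L l u = ⋂ i, {x | l i ≤ L.mulVec x i} ∩ {x | L.mulVec x i ≤ u i} := by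
    ext x
    simp [Cset]
  rw [this]
  exact MeasurableSet.iInter fun i =>
    ((isClosed_le continuous_const (hc i)).inter
      (isClosed_le (hc i) continuous_const)).measurableSet

theorem measurable_gdens_factor (L : Matrix (Fin d) (Fin d) ℝ) (l u μ : Fin d → ℝ) (k : Fin d) :
    Measurable fun x : Fin d → ℝ => stdPdf (x k - μ k) *
      (if lTil L l x k ≤ x k ∧ x k ≤ lTil L u x k then (1 : ℝ) else 0) /
      (Phi (lTil L u x k - μ k) - Phi (lTil L l x k - μ k)) := by
  have hx : Measurable fun x : Fin d → ℝ => x k := measurable_pi_apply k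
  have hl := (continuous_lTil L l k).measurable
  have hu := (continuous_lTil L u k).measurable
  have hP := strictMono_Phi.monotone.measurable
  refine ((continuous_stdPdf.measurable.comp (hx.sub_const _)).mul
    (Measurable.ite ?_ measurable_const measurable_const)).div
    ((hP.comp (hu.sub_const _)).sub (hP.comp (hl.sub_const _)))
  exact (measurableSet_le hl hx).inter (measurableSet_le hx hu)

theorem gdens_factor_nonneg (hDiag : ∀ i, 0 < L i i) (hlu : ∀ k, l k < u k) (x μ : Fin d → ℝ)
    (k : Fin d) : 0 ≤ stdPdf (x k - μ k) *
      (if lTil L l x k ≤ x k ∧ x k ≤ lTil L u x k then (1 : ℝ) else 0) /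
      (Phi (lTil L u x k - μ k) - Phi (lTil L l x k - μ k)) := by
  have h₁ := stdPdf_pos (x k - μ k)
  have h₂ := Phi_lTil_sub_pos hDiag hlu x μ k
  split_ifs <;> positivity

theorem gdens_nonneg (hDiag : ∀ i, 0 < L i i) (hlu : ∀ k, l k < u k) (x μ : Fin d → ℝ) :
    0 ≤ gdens L l u x μ :=
  Finset.prod_nonneg fun k _ => gdens_factor_nonneg hDiag hlu x μ k

theorem lintegral_gdens_le_one (hDiag : ∀ i, 0 < L i i) (hlu : ∀ k, l k < u k) (μ : Fin d → ℝ) :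
    ∫⁻ x, ENNReal.ofReal (gdens L l u x μ) ≤ 1 := by
  have h : ∀ x, ENNReal.ofReal (gdens L l u x μ) = ∏ k, ENNReal.ofReal (stdPdf (x k - μ k) *
      (if lTil L l x k ≤ x k ∧ x k ≤ lTil L u x k then (1 : ℝ) else 0) /
      (Phi (lTil L u x k - μ k) - Phi (lTil L l x k - μ k))) := fun x =>
    ENNReal.ofReal_prod_of_nonneg fun k _ => gdens_factor_nonneg hDiag hlu x μ k
  simp only [h]
  refine lintegral_prod_sequential_le_one _
    (fun k => (measurable_gdens_factor L l u μ k).ennreal_ofReal) (fun k x y hxy => ?_)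
    (fun k x => ?_)
  · rw [lTil_congr L l fun j hj => hxy j hj.le, lTil_congr L u fun j hj => hxy j hj.le,
      hxy k le_rfl]
  · have hupd : ∀ (v : Fin d → ℝ) (t : ℝ), lTil L v (Function.update x k t) k = lTil L v x k :=
      fun v t => lTil_congr L v fun j hj => Function.update_of_ne hj.ne _ _
    simp only [hupd, Function.update_self]
    exact lintegral_truncated_stdPdf_le_one (lTil_lt_lTil hDiag hlu x k) (μ k)

theorem integrable_gdens (hDiag : ∀ i, 0 < L i i) (hlu : ∀ k, l k < u k) (μ : Fin d → ℝ) :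
    Integrable fun x => gdens L l u x μ := by
  refine ⟨(Finset.measurable_prod _ fun k _ =>
    measurable_gdens_factor L l u μ k).aestronglyMeasurable, ?_⟩
  rw [hasFiniteIntegral_iff_ofReal (Eventually.of_forall fun x => gdens_nonneg hDiag hlu x μ)]
  exact (lintegral_gdens_le_one hDiag hlu μ).trans_lt ENNReal.one_lt_top

theorem integral_gdens_le_one (hDiag : ∀ i, 0 < L i i) (hlu : ∀ k, l k < u k) (μ : Fin d → ℝ) :
    ∫ x, gdens L l u x μ ≤ 1 := by
  rw [integral_eq_lintegral_of_nonneg_ae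
    (Eventually.of_forall fun x => gdens_nonneg hDiag hlu x μ)
    (integrable_gdens hDiag hlu μ).aestronglyMeasurable]
  exact ENNReal.toReal_le_of_le_ofReal zero_le_one
    (by simpa using lintegral_gdens_le_one hDiag hlu μ)

theorem phiD_pos (x : Fin d → ℝ) : 0 < phiD x := by
  unfold phiD
  positivity

theorem phiD_eq_prod (x : Fin d → ℝ) : phiD x = ∏ k, stdPdf (x k) := by
  simp only [phiD, stdPdf, Finset.prod_mul_distrib, ← Real.exp_sum, Finset.prod_const,
    Finset.card_univ, Fintype.card_fin, inv_pow]
  rw [← Finset.sum_neg_distrib, Finset.sum_div]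

theorem phiD_eq_exp_psi_mul_gdens (hLow : ∀ i j : Fin d, i < j → L i j = 0)
    (hDiag : ∀ i, 0 < L i i) (hlu : ∀ k, l k < u k) (μ : Fin d → ℝ) {x : Fin d → ℝ}
    (hx : x ∈ Cset L l u) : phiD x = Real.exp (psi L l u x μ) * gdens L l u x μ := by
  have hpsi : psi L l u x μ = ∑ k, (-(x k * μ k) + μ k ^ 2 / 2 +
      Real.log (Phi (lTil L u x k - μ k) - Phi (lTil L l x k - μ k))) := by
    simp only [psi, Finset.sum_add_distrib, Finset.sum_neg_distrib, Finset.sum_div]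
  rw [hpsi, Real.exp_sum, gdens, ← Finset.prod_mul_distrib, phiD_eq_prod]
  refine Finset.prod_congr rfl fun k _ => ?_
  have hD := Phi_lTil_sub_pos hDiag hlu x μ k
  have hexp : Real.exp (-x k ^ 2 / 2) = Real.exp (-(x k * μ k) + μ k ^ 2 / 2) *
      Real.exp (-(x k - μ k) ^ 2 / 2) := by
    rw [← Real.exp_add]
    congr 1
    ring
  rw [if_pos ((mem_Cset_iff hLow hDiag x).1 hx k), Real.exp_add, Real.exp_log hD, stdPdf, stdPdf,
    hexp]
  field_simp

end TiltedProposal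

/-- total-variation bound for the tilted proposal. With ℓ > 0, the truncated
normal density f = φ_d·1_𝒞/ℓ, and S(μ) = sup_{x∈𝒞} ψ(x;μ) finite, the KL divergence of g(·;μ)
from f is at most S(μ) − log ℓ, and hence
(1/2)∫|f − g(·;μ)| ≤ sqrt(1 − ℓ·exp(−S(μ))). -/
theorem tv_bound_tilted_proposal {d : ℕ} (hd : 1 ≤ d)
    (L : Matrix (Fin d) (Fin d) ℝ)
    (hLow : ∀ i j : Fin d, i < j → L i j = 0)
    (hDiag : ∀ i, 0 < L i i)
    (l u : Fin d → ℝ) (hlu : ∀ k, l k < u k)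
    (hl : 0 < lval L l u)
    (μ : Fin d → ℝ)
    (hbdd : BddAbove ((fun x => psi L l u x μ) '' Cset L l u)) :
    (∫ x : Fin d → ℝ,
        (Set.indicator (Cset L l u) phiD x / lval L l u) *
          Real.log ((Set.indicator (Cset L l u) phiD x / lval L l u) / gdens L l u x μ))
      ≤ sSup ((fun x => psi L l u x μ) '' Cset L l u) - Real.log (lval L l u) ∧
    (1 / 2) * (∫ x : Fin d → ℝ,
        |Set.indicator (Cset L l u) phiD x / lval L l u - gdens L l u x μ|)
      ≤ Real.sqrt (1 - lval L l u *
          Real.exp (-(sSup ((fun x => psi L l u x μ) '' Cset L l u)))) := by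
  set S := sSup ((fun x => psi L l u x μ) '' Cset L l u) with hS
  set ℓ := lval L l u with hℓ
  set f : (Fin d → ℝ) → ℝ := fun x => Set.indicator (Cset L l u) phiD x / ℓ with hf
  have hψ : ∀ x ∈ Cset L l u, psi L l u x μ ≤ S := fun x hx => le_csSup hbdd ⟨x, hx, rfl⟩
  have hC := measurableSet_Cset L l u
  have hφ : IntegrableOn phiD (Cset L l u) := by
    by_contra h
    rw [hℓ, lval, integral_undef h] at hl
    exact hl.false
  have hfint : Integrable f := (hφ.integrable_indicator hC).div_const ℓ
  have hf1 : ∫ x, f x = 1 := by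
    rw [hf, integral_div, integral_indicator hC]
    exact div_self hl.ne'
  have hf0 : ∀ x, 0 ≤ f x := fun x =>
    div_nonneg (Set.indicator_nonneg (fun y _ => (phiD_pos y).le) x) hl.le
  have hg0 := fun x => gdens_nonneg (L := L) hDiag hlu x μ
  have hgint := integrable_gdens (L := L) hDiag hlu μ
  have hg1 := integral_gdens_le_one (L := L) hDiag hlu μ
  set c := ℓ * Real.exp (-S) with hc
  have hc0 : 0 < c := by positivity
  have hfg : ∀ x, c * f x ≤ gdens L l u x μ := by
    intro x
    by_cases hx : x ∈ Cset L l u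
    · have h : c * f x = Real.exp (psi L l u x μ - S) * gdens L l u x μ := by
        simp only [hf, hc, Set.indicator_of_mem hx,
          phiD_eq_exp_psi_mul_gdens hLow hDiag hlu μ hx, sub_eq_add_neg, Real.exp_add]
        field_simp
      rw [h]
      exact mul_le_of_le_one_left (hg0 x) (Real.exp_le_one_iff.2 (sub_nonpos.2 (hψ x hx)))
    · simpa [hf, Set.indicator_of_notMem hx] using hg0 x
  have hc1 : c ≤ 1 := by
    have h := integral_mono (hfint.const_mul c) hgint hfg
    rw [integral_const_mul, hf1, mul_one] at h
    exact h.trans hg1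
  constructor
  · by_cases hint : Integrable fun x => f x * Real.log (f x / gdens L l u x μ)
    · have h := integral_mono hint (hfint.mul_const (S - Real.log ℓ)) fun x => by
        dsimp only
        by_cases hx : x ∈ Cset L l u
        · refine mul_le_mul_of_nonneg_left ?_ (hf0 x)
          have hfx : f x = Real.exp (psi L l u x μ) * gdens L l u x μ / ℓ := by
            simp only [hf, Set.indicator_of_mem hx,
              phiD_eq_exp_psi_mul_gdens hLow hDiag hlu μ hx]
          have hgx : gdens L l u x μ ≠ 0 := fun h0 => by
            have h := phiD_eq_exp_psi_mul_gdens hLow hDiag hlu μ hx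
            rw [h0, mul_zero] at h
            exact (phiD_pos x).ne' h
          have hq : f x / gdens L l u x μ = Real.exp (psi L l u x μ) / ℓ := by
            rw [hfx]
            field_simp
          rw [hq, Real.log_div (Real.exp_ne_zero _) hl.ne', Real.log_exp]
          exact sub_le_sub_right (hψ x hx) _
        · simp [hf, Set.indicator_of_notMem hx]
      rwa [integral_mul_const, hf1, one_mul] at h
    · rw [integral_undef hint]
      have h := Real.log_nonpos hc0.le hc1
      rw [hc, Real.log_mul hl.ne' (Real.exp_ne_zero _), Real.log_exp] at h
      linarith
  · have hpt : ∀ x, |f x - gdens L l u x μ| ≤ (1 - 2 * c) * f x + gdens L l u x μ := by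
      intro x
      have h₁ := hfg x
      have h₂ := mul_le_of_le_one_left (hf0 x) hc1
      exact abs_le.2 ⟨by linarith, by linarith⟩
    have h := integral_mono (hfint.sub hgint).abs ((hfint.const_mul (1 - 2 * c)).add hgint) hpt
    simp only [Pi.add_apply] at h
    rw [integral_add (hfint.const_mul _) hgint, integral_const_mul, hf1] at h
    refine le_trans (b := 1 - c) ?_ (Real.le_sqrt_of_sq_le ?_)
    · simp only [Pi.sub_apply] at h
      linarith
    · nlinarith
end

section
/- Explicit solution of the quadratic program: under the stated assumptions, the vector x* ∈ ℝ^d given by x*₁ = γ L₁₁^{-1} p₁ (first d₁ coordinates) and x*₂ = 0 (last d₂ coordinates) is the unique minimizer of (1/2)‖x‖² over the feasible set {x ∈ ℝ^d : Lx ≥ γ p} (componentwise), and the minimum value equals (γ²/2)‖L₁₁^{-1} p₁‖². -/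
open MeasureTheory Real Filter Matrix

/-- Upper-left d₁×d₁ block L₁₁ of a (d₁+d₂)×(d₁+d₂) matrix. -/
def blk11 {d₁ d₂ : ℕ} (L : Matrix (Fin (d₁ + d₂)) (Fin (d₁ + d₂)) ℝ) :
    Matrix (Fin d₁) (Fin d₁) ℝ := L.submatrix (Fin.castAdd d₂) (Fin.castAdd d₂)

/-- Lower-left d₂×d₁ block L₂₁. -/
def blk21 {d₁ d₂ : ℕ} (L : Matrix (Fin (d₁ + d₂)) (Fin (d₁ + d₂)) ℝ) :
    Matrix (Fin d₂) (Fin d₁) ℝ := L.submatrix (Fin.natAdd d₁) (Fin.castAdd d₂)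

/-- Lower-right d₂×d₂ block L₂₂. -/
def blk22 {d₁ d₂ : ℕ} (L : Matrix (Fin (d₁ + d₂)) (Fin (d₁ + d₂)) ℝ) :
    Matrix (Fin d₂) (Fin d₂) ℝ := L.submatrix (Fin.natAdd d₁) (Fin.natAdd d₁)

/-- First block p₁ of a vector p ∈ ℝ^{d₁+d₂}. -/
def vec1 {d₁ d₂ : ℕ} (p : Fin (d₁ + d₂) → ℝ) : Fin d₁ → ℝ := fun i => p (Fin.castAdd d₂ i)

/-- Second block p₂ of a vector p ∈ ℝ^{d₁+d₂}. -/
def vec2 {d₁ d₂ : ℕ} (p : Fin (d₁ + d₂) → ℝ) : Fin d₂ → ℝ := fun j => p (Fin.natAdd d₁ j)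

/-- λ₁ = L₁₁^{-T} L₁₁^{-1} p₁. -/
noncomputable def lam1 {d₁ d₂ : ℕ} (L : Matrix (Fin (d₁ + d₂)) (Fin (d₁ + d₂)) ℝ)
    (p : Fin (d₁ + d₂) → ℝ) : Fin d₁ → ℝ :=
  ((blk11 L)⁻¹)ᵀ.mulVec ((blk11 L)⁻¹.mulVec (vec1 p))

/-- q = L₂₁ L₁₁^{-1} p₁ − p₂. -/
noncomputable def qvec {d₁ d₂ : ℕ} (L : Matrix (Fin (d₁ + d₂)) (Fin (d₁ + d₂)) ℝ)
    (p : Fin (d₁ + d₂) → ℝ) : Fin d₂ → ℝ :=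
  fun j => (blk21 L).mulVec ((blk11 L)⁻¹.mulVec (vec1 p)) j - vec2 p j

/-- The feasible set / region of integration 𝒞_γ = {x : Lx ≥ γp}. -/
def Cgam {d : ℕ} (L : Matrix (Fin d) (Fin d) ℝ) (p : Fin d → ℝ) (γ : ℝ) :
    Set (Fin d → ℝ) := {x | ∀ i, γ * p i ≤ L.mulVec x i}

/-- ℓ(γ) = P(LZ ≥ γp) = ∫_{𝒞_γ} φ_d(x) dx. -/
noncomputable def ellGam {d : ℕ} (L : Matrix (Fin d) (Fin d) ℝ) (p : Fin d → ℝ) (γ : ℝ) : ℝ :=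
  ∫ x in Cgam L p γ, phiD x

/-- One-sided sequential bound l̃ᵧ_k(x) = (γ p_k − Σ_{j<k} L_{kj} x_j)/L_{kk}. -/
noncomputable def lTilGam {d : ℕ} (L : Matrix (Fin d) (Fin d) ℝ) (p : Fin d → ℝ) (γ : ℝ)
    (x : Fin d → ℝ) (k : Fin d) : ℝ :=
  (γ * p k - ∑ j ∈ Finset.Iio k, L k j * x j) / L k k

/-- ψ_γ(x;μ) = −xᵀμ + ‖μ‖²/2 + Σ_k log(1 − Φ(l̃ᵧ_k(x) − μ_k)). -/
noncomputable def psiGam {d : ℕ} (L : Matrix (Fin d) (Fin d) ℝ) (p : Fin d → ℝ) (γ : ℝ)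
    (x μ : Fin d → ℝ) : ℝ :=
  -(∑ i, x i * μ i) + (∑ i, μ i ^ 2) / 2 +
    ∑ k, Real.log (1 - Phi (lTilGam L p γ x k - μ k))

/-- Second moment of the exponentially tilted estimator with tilting parameter μ(γ):
M(γ) = ∫_{𝒞_γ} exp(ψ_γ(x;μ(γ))) φ_d(x) dx. -/
noncomputable def Mgam {d : ℕ} (L : Matrix (Fin d) (Fin d) ℝ) (p : Fin d → ℝ)
    (μstar : ℝ → Fin d → ℝ) (γ : ℝ) : ℝ :=
  ∫ x in Cgam L p γ, Real.exp (psiGam L p γ x (μstar γ)) * phiD x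

theorem isUnit_det_blk11 {d₁ d₂ : ℕ} (L : Matrix (Fin (d₁ + d₂)) (Fin (d₁ + d₂)) ℝ)
    (hLow : ∀ i j : Fin (d₁ + d₂), i < j → L i j = 0) (hDiag : ∀ i, L i i ≠ 0) :
    IsUnit (blk11 L).det := by
  have hT : (blk11 L).IsLowerTriangular := fun i j hij =>
    hLow _ _ (Fin.strictMono_castAdd d₂ (OrderDual.toDual_lt_toDual.mp hij))
  rw [Matrix.det_of_isLowerTriangular _ hT, isUnit_iff_ne_zero]
  exact Finset.prod_ne_zero_iff.mpr fun i _ => hDiag _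

theorem mulVec_castAdd_of_lower {d₁ d₂ : ℕ} (L : Matrix (Fin (d₁ + d₂)) (Fin (d₁ + d₂)) ℝ)
    (hLow : ∀ i j : Fin (d₁ + d₂), i < j → L i j = 0) (x : Fin (d₁ + d₂) → ℝ) (i : Fin d₁) :
    L.mulVec x (Fin.castAdd d₂ i) = (blk11 L).mulVec (vec1 x) i := by
  have h : ∀ j : Fin d₂, L (Fin.castAdd d₂ i) (Fin.natAdd d₁ j) = 0 := fun j =>
    hLow _ _ (by simp only [Fin.lt_def, Fin.val_castAdd, Fin.val_natAdd]; omega)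
  simp [Matrix.mulVec, dotProduct, Fin.sum_univ_add, h, blk11, vec1]

/-- The dual vector `lam1` certifies a lower bound on the linear functional `L₁₁⁻¹ p₁ ⬝ᵥ x₁`. -/
theorem mul_dotProduct_self_le_of_mem_Cgam {d₁ d₂ : ℕ}
    (L : Matrix (Fin (d₁ + d₂)) (Fin (d₁ + d₂)) ℝ)
    (hLow : ∀ i j : Fin (d₁ + d₂), i < j → L i j = 0) (hDiag : ∀ i, L i i ≠ 0)
    (p : Fin (d₁ + d₂) → ℝ) (γ : ℝ) (hlam : ∀ i, 0 ≤ lam1 L p i)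
    {x : Fin (d₁ + d₂) → ℝ} (hx : x ∈ Cgam L p γ) :
    γ * ((blk11 L)⁻¹.mulVec (vec1 p) ⬝ᵥ (blk11 L)⁻¹.mulVec (vec1 p)) ≤
      (blk11 L)⁻¹.mulVec (vec1 p) ⬝ᵥ vec1 x := by
  have hdet := isUnit_det_blk11 L hLow hDiag
  have key : ∀ v, lam1 L p ⬝ᵥ v =
      (blk11 L)⁻¹.mulVec (vec1 p) ⬝ᵥ (blk11 L)⁻¹.mulVec v := fun v => by
    rw [lam1, Matrix.mulVec_transpose, Matrix.dotProduct_mulVec]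
  calc _ = lam1 L p ⬝ᵥ (γ • vec1 p) := by rw [dotProduct_smul, key, smul_eq_mul]
    _ ≤ lam1 L p ⬝ᵥ (blk11 L).mulVec (vec1 x) := by
      refine Finset.sum_le_sum fun i _ => mul_le_mul_of_nonneg_left ?_ (hlam i)
      rw [← mulVec_castAdd_of_lower L hLow]
      exact hx _
    _ = _ := by rw [key, Matrix.mulVec_mulVec, Matrix.nonsing_inv_mul _ hdet, Matrix.one_mulVec]

theorem sum_sq_sub_add_sum_sq_le_of_mem_Cgam {d₁ d₂ : ℕ}
    (L : Matrix (Fin (d₁ + d₂)) (Fin (d₁ + d₂)) ℝ)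
    (hLow : ∀ i j : Fin (d₁ + d₂), i < j → L i j = 0) (hDiag : ∀ i, L i i ≠ 0)
    (p : Fin (d₁ + d₂) → ℝ) {γ : ℝ} (hγ : 0 ≤ γ) (hlam : ∀ i, 0 ≤ lam1 L p i)
    {x : Fin (d₁ + d₂) → ℝ} (hx : x ∈ Cgam L p γ) :
    ∑ i, (vec1 x i - γ * (blk11 L)⁻¹.mulVec (vec1 p) i) ^ 2 + ∑ j, vec2 x j ^ 2 ≤
      ∑ i, x i ^ 2 - γ ^ 2 * ∑ i, (blk11 L)⁻¹.mulVec (vec1 p) i ^ 2 := by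
  have h := mul_le_mul_of_nonneg_left
    (mul_dotProduct_self_le_of_mem_Cgam L hLow hDiag p γ hlam hx) hγ
  set a := (blk11 L)⁻¹.mulVec (vec1 p)
  have hexp : ∑ i, (vec1 x i - γ * a i) ^ 2 =
      ∑ i, vec1 x i ^ 2 - 2 * (γ * (a ⬝ᵥ vec1 x)) + γ * (γ * (a ⬝ᵥ a)) := by
    simp only [dotProduct, Finset.mul_sum, ← Finset.sum_sub_distrib, ← Finset.sum_add_distrib]
    exact Finset.sum_congr rfl fun i _ => by ring
  have hsplit : ∑ i, x i ^ 2 = ∑ i, vec1 x i ^ 2 + ∑ j, vec2 x j ^ 2 := Fin.sum_univ_add _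
  have hsq : γ ^ 2 * ∑ i, a i ^ 2 = γ * (γ * (a ⬝ᵥ a)) := by
    simp only [dotProduct, ← pow_two, ← mul_assoc]
  linarith

/-- explicit solution of the quadratic program min (1/2)‖x‖² s.t. Lx ≥ γp.
With λ₁ = L₁₁^{-T}L₁₁^{-1}p₁ ≥ 0 and q = L₂₁L₁₁^{-1}p₁ − p₂ ≥ 0, the vector
x* = (γL₁₁^{-1}p₁, 0) is the unique minimizer and the minimum equals (γ²/2)‖L₁₁^{-1}p₁‖². -/
theorem qp_explicit_solution {d₁ d₂ : ℕ} (hd₁ : 1 ≤ d₁)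
    (L : Matrix (Fin (d₁ + d₂)) (Fin (d₁ + d₂)) ℝ)
    (hLow : ∀ i j : Fin (d₁ + d₂), i < j → L i j = 0)
    (hDiag : ∀ i, L i i ≠ 0)
    (p : Fin (d₁ + d₂) → ℝ) (γ : ℝ) (hγ : 0 < γ)
    (hlam : ∀ i, 0 ≤ lam1 L p i)
    (hq : ∀ j, 0 ≤ qvec L p j) :
    (fun i : Fin (d₁ + d₂) =>
        if h : (i : ℕ) < d₁ then γ * (blk11 L)⁻¹.mulVec (vec1 p) ⟨i, h⟩ else 0) ∈ Cgam L p γ ∧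
    (∀ x ∈ Cgam L p γ,
      γ ^ 2 / 2 * ∑ i, ((blk11 L)⁻¹.mulVec (vec1 p) i) ^ 2 ≤ (1 / 2) * ∑ i, x i ^ 2) ∧
    (∀ x ∈ Cgam L p γ,
      (1 / 2) * ∑ i, x i ^ 2 = γ ^ 2 / 2 * ∑ i, ((blk11 L)⁻¹.mulVec (vec1 p) i) ^ 2 →
      x = fun i : Fin (d₁ + d₂) =>
        if h : (i : ℕ) < d₁ then γ * (blk11 L)⁻¹.mulVec (vec1 p) ⟨i, h⟩ else 0) ∧
    (1 / 2) * ∑ i : Fin (d₁ + d₂),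
        (if h : (i : ℕ) < d₁ then γ * (blk11 L)⁻¹.mulVec (vec1 p) ⟨i, h⟩ else 0) ^ 2 =
      γ ^ 2 / 2 * ∑ i, ((blk11 L)⁻¹.mulVec (vec1 p) i) ^ 2 := by
  have hdet := isUnit_det_blk11 L hLow hDiag
  have bound := fun x hx =>
    sum_sq_sub_add_sum_sq_le_of_mem_Cgam L hLow hDiag p hγ.le hlam (x := x) hx
  have hAa : (blk11 L).mulVec ((blk11 L)⁻¹.mulVec (vec1 p)) = vec1 p := by
    rw [Matrix.mulVec_mulVec, Matrix.mul_nonsing_inv _ hdet, Matrix.one_mulVec]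
  simp only [qvec] at hq
  set a := (blk11 L)⁻¹.mulVec (vec1 p)
  refine ⟨fun i => ?_, fun x hx => ?_, fun x hx hval => ?_, ?_⟩
  · refine Fin.addCases (fun i => ?_) (fun j => ?_) i
    · have hv : vec1 (fun i : Fin (d₁ + d₂) => if h : (i : ℕ) < d₁ then γ * a ⟨i, h⟩ else 0) =
          γ • a := by
        ext i
        simp [vec1]
      rw [mulVec_castAdd_of_lower L hLow, hv, Matrix.mulVec_smul, hAa]
      rfl
    · have hv : L.mulVec (fun i : Fin (d₁ + d₂) => if h : (i : ℕ) < d₁ then γ * a ⟨i, h⟩ else 0)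
          (Fin.natAdd d₁ j) = γ * (blk21 L).mulVec a j := by
        simp [Matrix.mulVec, dotProduct, Fin.sum_univ_add, blk21, Finset.mul_sum,
          mul_left_comm]
      rw [hv]
      exact mul_le_mul_of_nonneg_left (sub_nonneg.mp (hq j)) hγ.le
  · have h1 : 0 ≤ ∑ i, (vec1 x i - γ * a i) ^ 2 := Finset.sum_nonneg fun _ _ => sq_nonneg _
    have h2 : 0 ≤ ∑ j, vec2 x j ^ 2 := Finset.sum_nonneg fun _ _ => sq_nonneg _
    linarith [bound x hx]
  · have h1 : 0 ≤ ∑ i, (vec1 x i - γ * a i) ^ 2 := Finset.sum_nonneg fun _ _ => sq_nonneg _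
    have h2 : 0 ≤ ∑ j, vec2 x j ^ 2 := Finset.sum_nonneg fun _ _ => sq_nonneg _
    have h1' : ∑ i, (vec1 x i - γ * a i) ^ 2 = 0 := by linarith [bound x hx]
    have h2' : ∑ j, vec2 x j ^ 2 = 0 := by linarith [bound x hx]
    rw [Finset.sum_eq_zero_iff_of_nonneg fun _ _ => sq_nonneg _] at h1' h2'
    ext i
    refine Fin.addCases (fun i => ?_) (fun j => ?_) i
    · simpa [vec1, sub_eq_zero] using h1' i (Finset.mem_univ i)
    · simpa [vec2] using h2' j (Finset.mem_univ j)
  · simp only [Fin.sum_univ_add, Fin.val_castAdd, Fin.val_natAdd, Fin.is_lt, Fin.eta, dite_true,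
      mul_pow, ← Finset.mul_sum]
    simp
    ring
end

section
/- Gaussian tail asymptotics (Hashorva–Hüsler): let 𝒥 = {j ∈ {1,…,d₂} : q_j = 0} and let Y = (Y₁,…,Y_{d₂}) be a centered Gaussian vector on ℝ^{d₂} with covariance L₂₂L₂₂ᵀ. Set c = P(Y_j > 0 for all j ∈ 𝒥) / ((2π)^{d₁/2} det(L₁₁)) (so c = (2π)^{-d₁/2}/det(L₁₁) when 𝒥 = ∅). Then ℓ(γ) · exp((γ²/2)‖L₁₁^{-1}p₁‖²) · Π_{k=1}^{d₁} (γ (λ₁)_k) → c as γ → ∞; equivalently ℓ(γ) ≃ c · exp(−(γ²/2)‖L₁₁^{-1}p₁‖² − Σ_{k=1}^{d₁} log(γ(λ₁)_k)). -/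
open MeasureTheory Real Filter Matrix

/-- The indicator of the nonnegative orthant times the exponential weight `exp (-∑ yᵢ)`. -/
noncomputable def expWeight {ι : Type*} [Fintype ι] (y : ι → ℝ) : ℝ :=
  ∏ i, (Set.Ici (0 : ℝ)).indicator (fun t => Real.exp (-t)) (y i)

lemma expWeight_of_nonneg {ι : Type*} [Fintype ι] {y : ι → ℝ} (hy : ∀ i, 0 ≤ y i) :
    expWeight y = Real.exp (-∑ i, y i) := by
  rw [expWeight, ← Finset.sum_neg_distrib, Real.exp_sum]
  exact Finset.prod_congr rfl fun i _ => Set.indicator_of_mem (Set.mem_Ici.2 (hy i)) _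

lemma expWeight_of_not_nonneg {ι : Type*} [Fintype ι] {y : ι → ℝ} (hy : ¬ ∀ i, 0 ≤ y i) :
    expWeight y = 0 := by
  push Not at hy
  obtain ⟨i, hi⟩ := hy
  exact Finset.prod_eq_zero (Finset.mem_univ i)
    (Set.indicator_of_notMem (by simpa using hi) _)

lemma expWeight_nonneg {ι : Type*} [Fintype ι] (y : ι → ℝ) : 0 ≤ expWeight y :=
  Finset.prod_nonneg fun _ _ => Set.indicator_nonneg (fun _ _ => (Real.exp_pos _).le) _

lemma measurable_expWeight {ι : Type*} [Fintype ι] :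
    Measurable (expWeight : (ι → ℝ) → ℝ) := by
  unfold expWeight
  refine Finset.measurable_fun_prod _ fun i _ => ?_
  exact (Measurable.indicator (by fun_prop) measurableSet_Ici).comp (measurable_pi_apply i)

lemma integrable_expWeight {ι : Type*} [Fintype ι] :
    Integrable (expWeight : (ι → ℝ) → ℝ) := by
  refine Integrable.fintype_prod (f := fun _ : ι =>
    (Set.Ici (0 : ℝ)).indicator (fun t => Real.exp (-t))) fun i => ?_
  rw [integrable_indicator_iff measurableSet_Ici, integrableOn_Ici_iff_integrableOn_Ioi]
  exact integrableOn_exp_neg_Ioi 0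

lemma integral_expWeight {ι : Type*} [Fintype ι] : ∫ y : ι → ℝ, expWeight y = 1 := by
  have h : ∫ t, (Set.Ici (0 : ℝ)).indicator (fun t => Real.exp (-t)) t = 1 := by
    rw [integral_indicator measurableSet_Ici, integral_Ici_eq_integral_Ioi,
      integral_exp_neg_Ioi_zero]
  unfold expWeight
  rw [integral_fintype_prod_volume_eq_prod (fun (_ : ι) t =>
    (Set.Ici (0 : ℝ)).indicator (fun t => Real.exp (-t)) t)]
  simp [h]

lemma integrable_exp_neg_sum_sq {ι : Type*} [Fintype ι] :
    Integrable (fun z : ι → ℝ => Real.exp (-(∑ i, z i ^ 2) / 2)) := by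
  have h : Integrable (fun z : ι → ℝ => ∏ i, Real.exp (-(1 / 2) * z i ^ 2)) :=
    Integrable.fintype_prod (f := fun (_ : ι) t => Real.exp (-(1 / 2) * t ^ 2))
      fun i => integrable_exp_neg_mul_sq (by norm_num)
  refine h.congr (ae_of_all _ fun z => ?_)
  simp only [← Real.exp_sum, ← Finset.mul_sum]
  ring_nf

lemma ae_mulVec_apply_ne_zero {ι κ : Type*} [Fintype ι] [Fintype κ] (C : Matrix κ ι ℝ) (j : κ)
    (hC : C j ≠ 0) : ∀ᵐ z : ι → ℝ, C.mulVec z j ≠ 0 := by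
  classical
  have hker : LinearMap.ker (LinearMap.proj j ∘ₗ C.mulVecLin) ≠ ⊤ := by
    intro h
    apply hC
    ext i
    have : Pi.single i (1 : ℝ) ∈ LinearMap.ker (LinearMap.proj j ∘ₗ C.mulVecLin) := by
      rw [h]; trivial
    simpa using this
  have h0 := Measure.addHaar_submodule volume _ hker
  rw [ae_iff]
  refine Eq.trans (congrArg _ ?_) h0
  ext z
  simp

lemma integral_fin_append {m n : ℕ} (f : (Fin (m + n) → ℝ) → ℝ) :
    ∫ x, f x = ∫ w : (Fin m → ℝ) × (Fin n → ℝ), f (Fin.append w.1 w.2) := by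
  rw [← (volume_measurePreserving_piCongrLeft (fun _ => ℝ)
      (finSumFinEquiv (m := m) (n := n))).integral_comp' f,
    ← (volume_measurePreserving_sumPiEquivProdPi_symm
      (fun _ : Fin m ⊕ Fin n => ℝ)).integral_comp']
  refine integral_congr_ae (ae_of_all _ fun w => congrArg f ?_)
  funext i
  obtain ⟨s, rfl⟩ := finSumFinEquiv.surjective i
  refine (Equiv.piCongrLeft_apply_apply (fun _ => ℝ) _ _ s).trans ?_
  rcases s with s | s <;> simp [MeasurableEquiv.sumPiEquivProdPi, Equiv.sumPiEquivProdPi]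

lemma integral_comp_affine_fst {ι κ : Type*} [Fintype ι] [DecidableEq ι] [Fintype κ]
    (M : Matrix ι ι ℝ) (hM : M.det ≠ 0) (b : ι → ℝ) {F : (ι → ℝ) × (κ → ℝ) → ℝ}
    (hF : Measurable F) :
    ∫ w : (ι → ℝ) × (κ → ℝ), F (b + M.mulVec w.1, w.2) = |M.det⁻¹| * ∫ w, F w := by
  have hlin : Measurable (fun y : ι → ℝ => M.mulVec y) := by
    have : Continuous (fun y : ι → ℝ => M.mulVec y) := by fun_prop
    exact this.measurable
  have hg : Measurable (fun y : ι → ℝ => b + M.mulVec y) := hlin.const_add b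
  have hmap : Measure.map (fun y : ι → ℝ => b + M.mulVec y) volume
      = ENNReal.ofReal |M.det⁻¹| • volume := by
    have h1 := Real.map_matrix_volume_pi_eq_smul_volume_pi hM
    have h2 : Measure.map (fun y : ι → ℝ => b + M.mulVec y) volume
        = Measure.map (fun y => b + y) (Measure.map (fun y : ι → ℝ => M.mulVec y) volume) :=
      (Measure.map_map (measurable_const_add b) hlin).symm
    rw [h2]
    change Measure.map _ (Measure.map (⇑(Matrix.toLin' M)) volume) = _
    rw [h1, Measure.map_smul, map_add_left_eq_self]
  have hprod : Measure.map (Prod.map (fun y : ι → ℝ => b + M.mulVec y) (id : (κ → ℝ) → κ → ℝ))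
      volume = ENNReal.ofReal |M.det⁻¹| • volume := by
    rw [Measure.volume_eq_prod, ← Measure.map_prod_map _ _ hg measurable_id, hmap,
      Measure.map_id, Measure.prod_smul_left]
  have h := integral_map (hg.prodMap measurable_id).aemeasurable
    (hF.aestronglyMeasurable (μ := Measure.map (Prod.map (fun y : ι → ℝ => b + M.mulVec y)
      (id : (κ → ℝ) → κ → ℝ)) volume))
  rw [hprod, integral_smul_measure, ENNReal.toReal_ofReal (abs_nonneg _)] at h
  exact h.symm

/-- The rescaled Gaussian integrand, whose integral converges as `γ → ∞`. -/
noncomputable def rescaledIntegrand {ι κ : Type*} [Fintype ι] [Fintype κ] (N : Matrix ι ι ℝ)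
    (B : Matrix κ ι ℝ) (C : Matrix κ κ ℝ) (q : κ → ℝ) (γ : ℝ) (w : (ι → ℝ) × (κ → ℝ)) : ℝ :=
  expWeight w.1 * Real.exp (-(∑ i, (γ⁻¹ * N.mulVec w.1 i) ^ 2) / 2) *
    {z : κ → ℝ | ∀ j, 0 ≤ γ * q j + γ⁻¹ * B.mulVec (N.mulVec w.1) j + C.mulVec z j}.indicator
      (fun z => Real.exp (-(∑ i, z i ^ 2) / 2)) w.2

lemma measurable_rescaledIntegrand {ι κ : Type*} [Fintype ι] [Fintype κ] (N : Matrix ι ι ℝ)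
    (B : Matrix κ ι ℝ) (C : Matrix κ κ ℝ) (q : κ → ℝ) (γ : ℝ) :
    Measurable (rescaledIntegrand N B C q γ) := by
  unfold rescaledIntegrand
  refine ((measurable_expWeight.comp measurable_fst).mul ?_).mul ?_
  · have : Continuous (fun w : (ι → ℝ) × (κ → ℝ) =>
        Real.exp (-(∑ i, (γ⁻¹ * N.mulVec w.1 i) ^ 2) / 2)) := by
      simp only [Matrix.mulVec, dotProduct]; fun_prop
    exact this.measurable
  · have hS : MeasurableSet {w : (ι → ℝ) × (κ → ℝ) |
        ∀ j, 0 ≤ γ * q j + γ⁻¹ * B.mulVec (N.mulVec w.1) j + C.mulVec w.2 j} := by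
      refine IsClosed.measurableSet ?_
      simp only [Set.ofPred_forall]
      refine isClosed_iInter fun j => isClosed_le continuous_const ?_
      simp only [Matrix.mulVec, dotProduct]; fun_prop
    have hm : Measurable (fun w : (ι → ℝ) × (κ → ℝ) => Real.exp (-(∑ i, w.2 i ^ 2) / 2)) := by
      fun_prop
    exact hm.indicator hS

lemma tendsto_rescaledIntegrand {ι κ : Type*} [Fintype ι] [Fintype κ] (N : Matrix ι ι ℝ)
    (B : Matrix κ ι ℝ) (C : Matrix κ κ ℝ) (q : κ → ℝ) (hq : ∀ j, 0 ≤ q j)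
    (w : (ι → ℝ) × (κ → ℝ)) (hw : ∀ j, C.mulVec w.2 j ≠ 0) :
    Tendsto (fun γ => rescaledIntegrand N B C q γ w) atTop
      (nhds (expWeight w.1 * {z : κ → ℝ | ∀ j, q j = 0 → 0 < C.mulVec z j}.indicator
        (fun z => Real.exp (-(∑ i, z i ^ 2) / 2)) w.2)) := by
  have hinv : ∀ a : ℝ, Tendsto (fun γ : ℝ => γ⁻¹ * a) atTop (nhds 0) := fun a => by
    simpa using (tendsto_inv_atTop_zero (𝕜 := ℝ)).mul_const a
  have hexp : Tendsto (fun γ : ℝ => Real.exp (-(∑ i, (γ⁻¹ * N.mulVec w.1 i) ^ 2) / 2)) atTop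
      (nhds 1) := by
    have : Tendsto (fun γ : ℝ => -(∑ i, (γ⁻¹ * N.mulVec w.1 i) ^ 2) / 2) atTop (nhds 0) := by
      simpa using ((tendsto_finsetSum Finset.univ fun i _ =>
        (hinv (N.mulVec w.1 i)).pow 2).neg).div_const 2
    simpa [Function.comp_def] using (Real.continuous_exp.tendsto 0).comp this
  have hcond : ∀ᶠ γ : ℝ in atTop, ∀ j,
      (0 ≤ γ * q j + γ⁻¹ * B.mulVec (N.mulVec w.1) j + C.mulVec w.2 j ↔
        (q j = 0 → 0 < C.mulVec w.2 j)) := by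
    refine eventually_all.2 fun j => ?_
    have hs := (hinv (B.mulVec (N.mulVec w.1) j)).add_const (C.mulVec w.2 j)
    rw [zero_add] at hs
    rcases (hq j).eq_or_lt with h0 | h0
    · simp only [← h0, mul_zero, zero_add, forall_const]
      rcases lt_or_gt_of_ne (hw j) with h | h
      · filter_upwards [hs.eventually_lt_const h] with γ hγ
        exact ⟨fun h' => absurd h' hγ.not_ge, fun h' => absurd h' h.not_gt⟩
      · filter_upwards [hs.eventually_const_lt h] with γ hγ
        exact ⟨fun _ => h, fun _ => hγ.le⟩
    · have := (tendsto_id.atTop_mul_const h0).atTop_add hs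
      filter_upwards [this.eventually_ge_atTop 0] with γ hγ
      simp only [id] at hγ
      exact ⟨fun _ h => absurd h h0.ne', fun _ => by linarith⟩
  have hind : Tendsto (fun γ : ℝ => {z : κ → ℝ | ∀ j,
      0 ≤ γ * q j + γ⁻¹ * B.mulVec (N.mulVec w.1) j + C.mulVec z j}.indicator
        (fun z => Real.exp (-(∑ i, z i ^ 2) / 2)) w.2) atTop
      (nhds ({z : κ → ℝ | ∀ j, q j = 0 → 0 < C.mulVec z j}.indicator
        (fun z => Real.exp (-(∑ i, z i ^ 2) / 2)) w.2)) := by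
    refine tendsto_const_nhds.congr' ?_
    filter_upwards [hcond] with γ hγ
    simp only [Set.indicator_apply, Set.mem_ofPred_eq]
    exact if_congr (forall_congr' fun j => (hγ j).symm) rfl rfl
  simpa [rescaledIntegrand] using (hexp.const_mul (expWeight w.1)).mul hind

lemma tendsto_integral_rescaledIntegrand {ι κ : Type*} [Fintype ι] [Fintype κ]
    (N : Matrix ι ι ℝ) (B : Matrix κ ι ℝ) (C : Matrix κ κ ℝ) (hC : ∀ j, C j ≠ 0)
    (q : κ → ℝ) (hq : ∀ j, 0 ≤ q j) :
    Tendsto (fun γ => ∫ w, rescaledIntegrand N B C q γ w) atTop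
      (nhds (∫ z in {z : κ → ℝ | ∀ j, q j = 0 → 0 < C.mulVec z j},
        Real.exp (-(∑ i, z i ^ 2) / 2))) := by
  have hS : MeasurableSet {z : κ → ℝ | ∀ j, q j = 0 → 0 < C.mulVec z j} := by
    simp only [Set.ofPred_forall]
    refine MeasurableSet.iInter fun j => MeasurableSet.iInter fun _ =>
      (isOpen_lt continuous_const ?_).measurableSet
    simp only [Matrix.mulVec, dotProduct]; fun_prop
  have hlim : ∫ z in {z : κ → ℝ | ∀ j, q j = 0 → 0 < C.mulVec z j},
        Real.exp (-(∑ i, z i ^ 2) / 2) =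
      ∫ w : (ι → ℝ) × (κ → ℝ), expWeight w.1 *
        {z : κ → ℝ | ∀ j, q j = 0 → 0 < C.mulVec z j}.indicator
          (fun z => Real.exp (-(∑ i, z i ^ 2) / 2)) w.2 := by
    rw [Measure.volume_eq_prod, integral_prod_mul, integral_expWeight, one_mul,
      integral_indicator hS]
  rw [hlim]
  refine tendsto_integral_filter_of_dominated_convergence
    (fun w => expWeight w.1 * Real.exp (-(∑ i, w.2 i ^ 2) / 2))
    (Eventually.of_forall fun γ => (measurable_rescaledIntegrand N B C q γ).aestronglyMeasurable)
    (Eventually.of_forall fun γ => ae_of_all _ fun w => ?_)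
    (integrable_expWeight.mul_prod integrable_exp_neg_sum_sq) ?_
  · have h1 : Real.exp (-(∑ i, (γ⁻¹ * N.mulVec w.1 i) ^ 2) / 2) ≤ 1 := by
      rw [Real.exp_le_one_iff]
      have : 0 ≤ ∑ i, (γ⁻¹ * N.mulVec w.1 i) ^ 2 := Finset.sum_nonneg fun _ _ => sq_nonneg _
      linarith
    have hnn := expWeight_nonneg w.1
    have h0 : ∀ z : κ → ℝ, 0 ≤ Real.exp (-(∑ i, z i ^ 2) / 2) := fun _ => (Real.exp_pos _).le
    rw [rescaledIntegrand, Real.norm_of_nonneg (mul_nonneg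
      (mul_nonneg hnn (Real.exp_pos _).le) (Set.indicator_nonneg (fun z _ => h0 z) _))]
    exact mul_le_mul (mul_le_of_le_one_right hnn h1)
      (Set.indicator_le_self' (fun z _ => h0 z) _)
      (Set.indicator_nonneg (fun z _ => h0 z) _) hnn
  · have hae : ∀ᵐ z : κ → ℝ, ∀ j, C.mulVec z j ≠ 0 :=
      ae_all_iff.2 fun j => ae_mulVec_apply_ne_zero C j (hC j)
    have hae' : ∀ᵐ w : (ι → ℝ) × (κ → ℝ), ∀ j, C.mulVec w.2 j ≠ 0 := by
      rw [Measure.volume_eq_prod]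
      exact Measure.quasiMeasurePreserving_snd.ae hae
    filter_upwards [hae'] with w hw
    exact tendsto_rescaledIntegrand N B C q hq w hw

lemma mulVec_append_castAdd {d₁ d₂ : ℕ} {L : Matrix (Fin (d₁ + d₂)) (Fin (d₁ + d₂)) ℝ}
    (hLow : ∀ i j : Fin (d₁ + d₂), i < j → L i j = 0)
    (u : Fin d₁ → ℝ) (z : Fin d₂ → ℝ) (i : Fin d₁) :
    L.mulVec (Fin.append u z) (Fin.castAdd d₂ i) = (blk11 L).mulVec u i := by
  have h : ∀ j : Fin d₂, L (Fin.castAdd d₂ i) (Fin.natAdd d₁ j) = 0 := fun j =>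
    hLow _ _ (by simp only [Fin.lt_def, Fin.val_castAdd, Fin.val_natAdd]; omega)
  simp [Matrix.mulVec, dotProduct, Fin.sum_univ_add, blk11, h]

lemma mulVec_append_natAdd {d₁ d₂ : ℕ} (L : Matrix (Fin (d₁ + d₂)) (Fin (d₁ + d₂)) ℝ)
    (u : Fin d₁ → ℝ) (z : Fin d₂ → ℝ) (j : Fin d₂) :
    L.mulVec (Fin.append u z) (Fin.natAdd d₁ j) =
      (blk21 L).mulVec u j + (blk22 L).mulVec z j := by
  simp [Matrix.mulVec, dotProduct, Fin.sum_univ_add, blk21, blk22]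

lemma det_blk11_pos {d₁ d₂ : ℕ} {L : Matrix (Fin (d₁ + d₂)) (Fin (d₁ + d₂)) ℝ}
    (hLow : ∀ i j : Fin (d₁ + d₂), i < j → L i j = 0) (hDiag : ∀ i, 0 < L i i) :
    0 < (blk11 L).det := by
  rw [Matrix.det_of_isLowerTriangular (blk11 L) (fun i j hij => hLow _ _
    (Fin.strictMono_castAdd d₂ (OrderDual.toDual_lt_toDual.1 hij)))]
  exact Finset.prod_pos fun i _ => hDiag _

lemma phiD_append {d₁ d₂ : ℕ} (u : Fin d₁ → ℝ) (z : Fin d₂ → ℝ) :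
    phiD (Fin.append u z) = ((Real.sqrt (2 * Real.pi)) ^ (d₁ + d₂))⁻¹ *
      Real.exp (-(∑ i, u i ^ 2) / 2) * Real.exp (-(∑ i, z i ^ 2) / 2) := by
  rw [phiD, mul_assoc, ← Real.exp_add]
  simp only [Fin.sum_univ_add, Fin.append_left, Fin.append_right]
  ring_nf

lemma measurableSet_Cgam {d : ℕ} (L : Matrix (Fin d) (Fin d) ℝ) (p : Fin d → ℝ) (γ : ℝ) :
    MeasurableSet (Cgam L p γ) := by
  refine IsClosed.measurableSet ?_
  simp only [Cgam, Set.ofPred_forall]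
  refine isClosed_iInter fun j => isClosed_le continuous_const ?_
  simp only [Matrix.mulVec, dotProduct]; fun_prop

lemma append_mem_Cgam_iff {d₁ d₂ : ℕ} {L : Matrix (Fin (d₁ + d₂)) (Fin (d₁ + d₂)) ℝ}
    (hLow : ∀ i j : Fin (d₁ + d₂), i < j → L i j = 0) (hdet : 0 < (blk11 L).det)
    (p : Fin (d₁ + d₂) → ℝ) (hlam : ∀ i, 0 < lam1 L p i) {γ : ℝ} (hγ : 0 < γ)
    (y : Fin d₁ → ℝ) (z : Fin d₂ → ℝ) :
    Fin.append (γ • (blk11 L)⁻¹.mulVec (vec1 p) +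
        (γ⁻¹ • ((blk11 L)⁻¹ * diagonal (lam1 L p)⁻¹)).mulVec y) z ∈ Cgam L p γ ↔
      (∀ i, 0 ≤ y i) ∧ ∀ j, 0 ≤ γ * qvec L p j + γ⁻¹ * (blk21 L).mulVec
        (((blk11 L)⁻¹ * diagonal (lam1 L p)⁻¹).mulVec y) j + (blk22 L).mulVec z j := by
  have hu : IsUnit (blk11 L).det := hdet.ne'.isUnit
  rw [Cgam, Set.mem_ofPred_eq, Fin.forall_fin_add]
  refine and_congr (forall_congr' fun i => ?_) (forall_congr' fun j => ?_)
  · rw [mulVec_append_castAdd hLow, mulVec_add, mulVec_smul, mulVec_mulVec,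
      Matrix.mul_nonsing_inv _ hu, one_mulVec, mulVec_mulVec, Matrix.mul_smul,
      Matrix.mul_nonsing_inv_cancel_left _ _ hu, smul_mulVec]
    simp only [Pi.add_apply, Pi.smul_apply, smul_eq_mul, mulVec_diagonal, vec1, Pi.inv_apply,
      le_add_iff_nonneg_right]
    rw [mul_nonneg_iff_of_pos_left (inv_pos.2 hγ),
      mul_nonneg_iff_of_pos_left (inv_pos.2 (hlam i))]
  · rw [mulVec_append_natAdd, mulVec_add, mulVec_smul, smul_mulVec, mulVec_smul, ← sub_nonneg]
    simp only [Pi.add_apply, Pi.smul_apply, smul_eq_mul, qvec, vec2]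
    ring_nf

lemma sum_sq_shift {d₁ d₂ : ℕ} (L : Matrix (Fin (d₁ + d₂)) (Fin (d₁ + d₂)) ℝ)
    (p : Fin (d₁ + d₂) → ℝ) (hlam : ∀ i, 0 < lam1 L p i) {γ : ℝ} (hγ : 0 < γ)
    (y : Fin d₁ → ℝ) :
    ∑ i, (γ • (blk11 L)⁻¹.mulVec (vec1 p) +
        (γ⁻¹ • ((blk11 L)⁻¹ * diagonal (lam1 L p)⁻¹)).mulVec y) i ^ 2 =
      γ ^ 2 * ∑ i, (blk11 L)⁻¹.mulVec (vec1 p) i ^ 2 + 2 * ∑ i, y i +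
        ∑ i, (γ⁻¹ * ((blk11 L)⁻¹ * diagonal (lam1 L p)⁻¹).mulVec y i) ^ 2 := by
  have hcross : ∑ i, (blk11 L)⁻¹.mulVec (vec1 p) i *
      ((blk11 L)⁻¹ * diagonal (lam1 L p)⁻¹).mulVec y i = ∑ i, y i := by
    change (blk11 L)⁻¹.mulVec (vec1 p) ⬝ᵥ _ = _
    rw [← mulVec_mulVec, dotProduct_mulVec, ← mulVec_transpose]
    change ∑ i, lam1 L p i * _ = _
    refine Finset.sum_congr rfl fun i _ => ?_
    rw [mulVec_diagonal, Pi.inv_apply, mul_inv_cancel_left₀ (hlam i).ne']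
  rw [← hcross, Finset.mul_sum, Finset.mul_sum, ← Finset.sum_add_distrib,
    ← Finset.sum_add_distrib]
  refine Finset.sum_congr rfl fun i _ => ?_
  simp only [smul_mulVec, Pi.add_apply, Pi.smul_apply, smul_eq_mul]
  field_simp
  ring

lemma indicator_phiD_append {d₁ d₂ : ℕ} {L : Matrix (Fin (d₁ + d₂)) (Fin (d₁ + d₂)) ℝ}
    (hLow : ∀ i j : Fin (d₁ + d₂), i < j → L i j = 0) (hdet : 0 < (blk11 L).det)
    (p : Fin (d₁ + d₂) → ℝ) (hlam : ∀ i, 0 < lam1 L p i) {γ : ℝ} (hγ : 0 < γ)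
    (w : (Fin d₁ → ℝ) × (Fin d₂ → ℝ)) :
    (Cgam L p γ).indicator phiD (Fin.append (γ • (blk11 L)⁻¹.mulVec (vec1 p) +
        (γ⁻¹ • ((blk11 L)⁻¹ * diagonal (lam1 L p)⁻¹)).mulVec w.1) w.2) =
      ((Real.sqrt (2 * Real.pi)) ^ (d₁ + d₂))⁻¹ *
        Real.exp (-(γ ^ 2 / 2 * ∑ i, ((blk11 L)⁻¹.mulVec (vec1 p) i) ^ 2)) *
        rescaledIntegrand ((blk11 L)⁻¹ * diagonal (lam1 L p)⁻¹) (blk21 L) (blk22 L)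
          (qvec L p) γ w := by
  classical
  rw [Set.indicator_apply, rescaledIntegrand, Set.indicator_apply]
  simp only [append_mem_Cgam_iff hLow hdet p hlam hγ, Set.mem_ofPred_eq]
  by_cases hy : ∀ i, 0 ≤ w.1 i
  · by_cases hz : ∀ j, 0 ≤ γ * qvec L p j + γ⁻¹ * (blk21 L).mulVec
        (((blk11 L)⁻¹ * diagonal (lam1 L p)⁻¹).mulVec w.1) j + (blk22 L).mulVec w.2 j
    · rw [if_pos ⟨hy, hz⟩, if_pos hz, phiD_append, sum_sq_shift L p hlam hγ,
        expWeight_of_nonneg hy]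
      simp only [mul_assoc, ← Real.exp_add]
      ring_nf
    · rw [if_neg fun h => hz h.2, if_neg hz, mul_zero, mul_zero]
  · rw [if_neg fun h => hy h.1, expWeight_of_not_nonneg hy]
    simp

lemma ellGam_mul_exp_mul_prod {d₁ d₂ : ℕ} {L : Matrix (Fin (d₁ + d₂)) (Fin (d₁ + d₂)) ℝ}
    (hLow : ∀ i j : Fin (d₁ + d₂), i < j → L i j = 0) (hdet : 0 < (blk11 L).det)
    (p : Fin (d₁ + d₂) → ℝ) (hlam : ∀ i, 0 < lam1 L p i) {γ : ℝ} (hγ : 0 < γ) :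
    ellGam L p γ * Real.exp (γ ^ 2 / 2 * ∑ i, ((blk11 L)⁻¹.mulVec (vec1 p) i) ^ 2) *
        ∏ k : Fin d₁, (γ * lam1 L p k) =
      ((Real.sqrt (2 * Real.pi)) ^ (d₁ + d₂))⁻¹ / (blk11 L).det *
        ∫ w, rescaledIntegrand ((blk11 L)⁻¹ * diagonal (lam1 L p)⁻¹) (blk21 L) (blk22 L)
          (qvec L p) γ w := by
  have hprod : 0 < ∏ k : Fin d₁, (γ * lam1 L p k) :=
    Finset.prod_pos fun k _ => mul_pos hγ (hlam k)
  have hM : (γ⁻¹ • ((blk11 L)⁻¹ * diagonal (lam1 L p)⁻¹)).det =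
      ((blk11 L).det * ∏ k : Fin d₁, (γ * lam1 L p k))⁻¹ := by
    rw [det_smul, det_mul, det_nonsing_inv, Ring.inverse_eq_inv', det_diagonal,
      Finset.prod_mul_distrib]
    simp only [Pi.inv_apply, Finset.prod_inv_distrib, Finset.prod_const, Finset.card_univ,
      mul_inv, inv_pow]
    ring
  have hpos := mul_pos hdet hprod
  have hmeas : Measurable fun w : (Fin d₁ → ℝ) × (Fin d₂ → ℝ) =>
      (Cgam L p γ).indicator phiD (Fin.append w.1 w.2) := by
    have hphi : Measurable (phiD : (Fin (d₁ + d₂) → ℝ) → ℝ) := by unfold phiD; fun_prop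
    exact (hphi.indicator (measurableSet_Cgam L p γ)).comp
      (Fin.appendHomeomorph d₁ d₂).continuous.measurable
  have hcov := integral_comp_affine_fst (γ⁻¹ • ((blk11 L)⁻¹ * diagonal (lam1 L p)⁻¹))
    (by rw [hM]; exact (inv_pos.2 hpos).ne') (γ • (blk11 L)⁻¹.mulVec (vec1 p)) hmeas
  simp only [indicator_phiD_append hLow hdet p hlam hγ] at hcov
  rw [hM, inv_inv, abs_of_pos hpos, integral_const_mul,
    ← integral_fin_append ((Cgam L p γ).indicator phiD),
    integral_indicator (measurableSet_Cgam L p γ), Real.exp_neg] at hcov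
  rw [ellGam]
  have hE := Real.exp_pos (γ ^ 2 / 2 * ∑ i, ((blk11 L)⁻¹.mulVec (vec1 p) i) ^ 2)
  field_simp at hcov ⊢
  linarith

/-- Hashorva–Hüsler Gaussian tail asymptotics: with 𝒥 = {j : q_j = 0} and
c = P(Y_j > 0 ∀j ∈ 𝒥)/((2π)^{d₁/2} det L₁₁) where Y = L₂₂Z' is N(0, L₂₂L₂₂ᵀ), one has
ℓ(γ)·exp((γ²/2)‖L₁₁^{-1}p₁‖²)·Π_k (γ(λ₁)_k) → c as γ → ∞. -/
theorem gaussian_tail_asymptotics {d₁ d₂ : ℕ} (hd₁ : 1 ≤ d₁)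
    (L : Matrix (Fin (d₁ + d₂)) (Fin (d₁ + d₂)) ℝ)
    (hLow : ∀ i j : Fin (d₁ + d₂), i < j → L i j = 0)
    (hDiag : ∀ i, 0 < L i i)
    (p : Fin (d₁ + d₂) → ℝ) (hp : ∀ i, 0 < p i)
    (hlam : ∀ i, 0 < lam1 L p i)
    (hq : ∀ j, 0 ≤ qvec L p j) :
    Tendsto
      (fun γ : ℝ => ellGam L p γ *
        Real.exp (γ ^ 2 / 2 * ∑ i, ((blk11 L)⁻¹.mulVec (vec1 p) i) ^ 2) *
        ∏ k : Fin d₁, (γ * lam1 L p k))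
      atTop
      (nhds ((∫ z in {z : Fin d₂ → ℝ | ∀ j, qvec L p j = 0 → 0 < (blk22 L).mulVec z j},
          phiD z) /
        ((Real.sqrt (2 * Real.pi)) ^ d₁ * (blk11 L).det))) := by
  have hdet := det_blk11_pos hLow hDiag
  have hC : ∀ j, blk22 L j ≠ 0 := fun j h => (hDiag (Fin.natAdd d₁ j)).ne' (congrFun h j)
  have hlim := (tendsto_integral_rescaledIntegrand ((blk11 L)⁻¹ * diagonal (lam1 L p)⁻¹)
    (blk21 L) (blk22 L) hC (qvec L p) hq).const_mul
      (((Real.sqrt (2 * Real.pi)) ^ (d₁ + d₂))⁻¹ / (blk11 L).det)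
  have hval : (∫ z in {z : Fin d₂ → ℝ | ∀ j, qvec L p j = 0 → 0 < (blk22 L).mulVec z j},
        phiD z) / ((Real.sqrt (2 * Real.pi)) ^ d₁ * (blk11 L).det) =
      ((Real.sqrt (2 * Real.pi)) ^ (d₁ + d₂))⁻¹ / (blk11 L).det *
        ∫ z in {z : Fin d₂ → ℝ | ∀ j, qvec L p j = 0 → 0 < (blk22 L).mulVec z j},
          Real.exp (-(∑ i, z i ^ 2) / 2) := by
    simp only [phiD, integral_const_mul, pow_add, mul_inv]
    field_simp
  rw [hval]
  refine hlim.congr' ?_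
  filter_upwards [eventually_gt_atTop 0] with γ hγ
  exact (ellGam_mul_exp_mul_prod hLow hdet p hlam hγ).symm
end
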